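/- The q-Painlevé II map has a singularity-confinement pattern at xy + 1 = 0 with confinement after 7 steps: over the field of rational functions K = F(y, ε) (or as a limit ε → 0), if x_n = −1/y_n + ε, then as ε → 0 the 7-th iterate of the qP_II map Φ (with parameter τ multiplied by q at each step) tends to (−1/(a q^{12} τ⁴ y_n), a q^{12} τ⁴ y_n), where τ is the parameter value at step n. Formally: over the field F(y)((ε)) of formal Laurent series, with x = −1/y + ε, the composition Φ_{n+6} ∘ ⋯ ∘ Φ_n applied to (x, y) has both coordinates in F(y)[[ε]] and its constant term (ε = 0) is (−1/(a q^{12} τ⁴ y), a q^{12} τ⁴ y). -/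

import Mathlib

/-- One step of the qP_II map with parameter t:
(x, y) ↦ ((a t² x − (t − x)(1 + xy)) / (x (t − x)(xy + 1)), x). -/
noncomputable def qp2Step {L : Type*} [Field L] (a t : L) (P : L × L) : L × L :=
  ((a * t ^ 2 * P.1 - (t - P.1) * (1 + P.1 * P.2)) / (P.1 * (t - P.1) * (P.1 * P.2 + 1)),
    P.1)

/-- `f = ε^k (c + O(ε))`: `f` has order at least `k` and its coefficient at `k` is `c`. -/
def Lead {K : Type*} [Field K] (f : LaurentSeries K) (k : ℤ) (c : K) : Prop :=
  ∃ p : PowerSeries K, f = HahnSeries.single k 1 * HahnSeries.ofPowerSeries ℤ K p ∧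
    PowerSeries.constantCoeff p = c

section
variable {K : Type*} [Field K]

lemma Lead.mul {f g : LaurentSeries K} {k l : ℤ} {c d : K} (hf : Lead f k c) (hg : Lead g l d) :
    Lead (f * g) (k + l) (c * d) := by
  obtain ⟨p, rfl, rfl⟩ := hf
  obtain ⟨r, rfl, rfl⟩ := hg
  refine ⟨p * r, ?_, by simp⟩
  have : (HahnSeries.single (k + l) 1 : LaurentSeries K) =
      HahnSeries.single k 1 * HahnSeries.single l 1 := by
    rw [HahnSeries.single_mul_single, one_mul]
  rw [this, map_mul]; ring

lemma Lead.ne_zero {f : LaurentSeries K} {k : ℤ} {c : K} (hf : Lead f k c) (hc : c ≠ 0) :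
    f ≠ 0 := by
  obtain ⟨p, rfl, rfl⟩ := hf
  refine mul_ne_zero (by simp) ?_
  intro h
  have : p = 0 := HahnSeries.ofPowerSeries_injective (Γ := ℤ) (by simpa using h)
  simp [this] at hc

lemma Lead.inv {f : LaurentSeries K} {k : ℤ} {c : K} (hf : Lead f k c) (hc : c ≠ 0) :
    Lead f⁻¹ (-k) c⁻¹ := by
  obtain ⟨p, rfl, rfl⟩ := hf
  refine ⟨p⁻¹, ?_, by simp⟩
  apply inv_eq_of_mul_eq_one_right
  have h1 : (HahnSeries.single k 1 : LaurentSeries K) * HahnSeries.single (-k) 1 = 1 := by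
    rw [HahnSeries.single_mul_single]; simp
  have h2 : HahnSeries.ofPowerSeries ℤ K p * HahnSeries.ofPowerSeries ℤ K p⁻¹ = 1 := by
    rw [← map_mul, PowerSeries.mul_inv_cancel _ hc, map_one]
  calc _ = (HahnSeries.single k 1 * HahnSeries.single (-k) 1) *
      (HahnSeries.ofPowerSeries ℤ K p * HahnSeries.ofPowerSeries ℤ K p⁻¹) := by ring
    _ = 1 := by rw [h1, h2, one_mul]

lemma Lead.div {f g : LaurentSeries K} {k l : ℤ} {c d : K} (hf : Lead f k c) (hg : Lead g l d)
    (hd : d ≠ 0) : Lead (f / g) (k - l) (c / d) := by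
  rw [div_eq_mul_inv, div_eq_mul_inv, sub_eq_add_neg]
  exact hf.mul (hg.inv hd)

lemma Lead.weaken {f : LaurentSeries K} {k : ℤ} {c : K} (hf : Lead f k c) (m : ℤ) (hm : m < k) :
    Lead f m 0 := by
  obtain ⟨p, rfl, rfl⟩ := hf
  obtain ⟨n, rfl⟩ : ∃ n : ℕ, k = m + (n + 1 : ℕ) := ⟨(k - m - 1).toNat, by omega⟩
  refine ⟨PowerSeries.X ^ (n + 1) * p, ?_, by simp⟩
  rw [map_mul, HahnSeries.ofPowerSeries_X_pow, ← mul_assoc, HahnSeries.single_mul_single, one_mul]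

lemma Lead.sub {f g : LaurentSeries K} {k : ℤ} {c d : K} (hf : Lead f k c) (hg : Lead g k d) :
    Lead (f - g) k (c - d) := by
  obtain ⟨p, rfl, rfl⟩ := hf
  obtain ⟨r, rfl, rfl⟩ := hg
  exact ⟨p - r, by rw [map_sub]; ring, by simp⟩

lemma Lead.C (c : K) : Lead (HahnSeries.C c) 0 c :=
  ⟨PowerSeries.C c, by simp, by simp⟩

lemma Lead.one : Lead (1 : LaurentSeries K) 0 1 := ⟨1, by simp, by simp⟩

lemma Lead.coeff {f : LaurentSeries K} {c : K} (hf : Lead f 0 c) :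
    (∀ i : ℤ, i < 0 → f.coeff i = 0) ∧ f.coeff 0 = c := by
  obtain ⟨p, rfl, rfl⟩ := hf
  have h1 : (HahnSeries.single 0 1 : LaurentSeries K) = 1 := rfl
  rw [h1, one_mul]
  constructor
  · intro i hi
    rw [HahnSeries.ofPowerSeries_apply]
    apply HahnSeries.embDomain_of_notMem_range
    rintro ⟨n, hn⟩
    simp at hn
    omega
  · have := HahnSeries.ofPowerSeries_apply_coeff (Γ := ℤ) p 0
    simpa using this

/-- The next value of `x * y + 1`. -/
lemma step_eq {L : Type*} [Field L] (a t x y P : L) (hP : x * y + 1 = P) (hP0 : P ≠ 0)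
    (hx : x ≠ 0) (ht : t - x ≠ 0) :
    ∃ P' x' : L, P' = a * t ^ 2 * x / ((t - x) * P) ∧ x' = (P' - 1) / x ∧
      x' * x + 1 = P' ∧ qp2Step a t (x, y) = (x', x) := by
  refine ⟨_, _, rfl, rfl, ?_, ?_⟩
  · field_simp; ring
  · simp only [qp2Step, Prod.mk.injEq, and_true]
    rw [add_comm 1, hP]
    field_simp

lemma step_lead (a t : K) (x y P : LaurentSeries K) (hP : x * y + 1 = P)
    {k m l k' : ℤ} {c e d c' : K} (hx : Lead x k c) (ht : Lead (HahnSeries.C t - x) m e)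
    (hPl : Lead P l d) (hc : c ≠ 0) (he : e ≠ 0) (hd : d ≠ 0)
    (hk : k' = k - m - l) (hcc : c' = a * t ^ 2 * c / (e * d)) :
    ∃ P' x' : LaurentSeries K, Lead P' k' c' ∧ x' = (P' - 1) / x ∧
      x' * x + 1 = P' ∧ qp2Step (HahnSeries.C a) (HahnSeries.C t) (x, y) = (x', x) := by
  obtain ⟨P', x', h1, h2, h3, h4⟩ := step_eq (HahnSeries.C a) (HahnSeries.C t) x y P hP
    (hPl.ne_zero hd) (hx.ne_zero hc) (ht.ne_zero he)
  refine ⟨P', x', ?_, h2, h3, h4⟩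
  rw [h1, hk, hcc, ← map_pow, ← map_mul]
  have := ((Lead.C (a * t ^ 2)).mul hx).div (ht.mul hPl) (mul_ne_zero he hd)
  convert this using 1
  ring

lemma Lead.congr {f g : LaurentSeries K} {k l : ℤ} {c d : K} (hf : Lead f k c) (h : g = f)
    (hk : l = k) (hc : d = c) : Lead g l d := by
  subst h hk hc; exact hf

/-- The confinement computation over an arbitrary coefficient field. -/
lemma confinement (a q τ y : K) (ha : a ≠ 0) (hq : q ≠ 0) (hτ : τ ≠ 0) (hy : y ≠ 0)
    (h1 : τ * y + 1 ≠ 0) (h2 : a * q ^ 6 * τ ^ 3 * y - 1 ≠ 0) :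
    ∃ x6 x7 : LaurentSeries K, Lead x6 0 (a * q ^ 12 * τ ^ 4 * y) ∧
      Lead x7 0 (-(1 / (a * q ^ 12 * τ ^ 4 * y))) ∧
      qp2Step (HahnSeries.C a) (HahnSeries.C (q ^ 6 * τ))
        (qp2Step (HahnSeries.C a) (HahnSeries.C (q ^ 5 * τ))
        (qp2Step (HahnSeries.C a) (HahnSeries.C (q ^ 4 * τ))
        (qp2Step (HahnSeries.C a) (HahnSeries.C (q ^ 3 * τ))
        (qp2Step (HahnSeries.C a) (HahnSeries.C (q ^ 2 * τ))
        (qp2Step (HahnSeries.C a) (HahnSeries.C (q * τ))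
        (qp2Step (HahnSeries.C a) (HahnSeries.C τ)
          (-(HahnSeries.C y)⁻¹ + HahnSeries.single 1 1, HahnSeries.C y))))))) = (x7, x6) := by
  obtain ⟨x0, hx0⟩ : ∃ x0 : LaurentSeries K, x0 = -(HahnSeries.C y)⁻¹ + HahnSeries.single 1 1 :=
    ⟨_, rfl⟩
  rw [← hx0]
  have hyL : (HahnSeries.C y : LaurentSeries K) ≠ 0 := (Lead.C y).ne_zero hy
  have hε : Lead (HahnSeries.single 1 1 : LaurentSeries K) 1 1 := ⟨1, by simp, by simp⟩
  have l0 : Lead x0 0 (-1 / y) :=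
    ((hε.weaken 0 (by norm_num)).sub ((Lead.C y).inv hy)).congr (by rw [hx0]; ring) rfl
      (by field_simp; ring)
  have lP : Lead (x0 * HahnSeries.C y + 1) 1 y :=
    (hε.mul (Lead.C y)).congr (by rw [hx0]; field_simp; ring) (by norm_num) (by ring)
  -- step 0
  have lt0 : Lead (HahnSeries.C τ - x0) 0 ((τ * y + 1) / y) :=
    ((Lead.C τ).sub l0).congr rfl rfl (by field_simp; ring)
  obtain ⟨P0, x1, lP0, e1, r1, s1⟩ := step_lead a τ x0 _ _ rfl (k' := -1)
    (c' := -(a * τ ^ 2 / ((τ * y + 1) * y))) l0 lt0 lP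
    (by simp [hy]) (by simp [ha, hq, hτ, hy, h1, h2]) hy (by norm_num) (by field_simp)
  have l1 : Lead x1 (-1) (a * τ ^ 2 / (τ * y + 1)) :=
    ((lP0.sub (Lead.one.weaken (-1) (by norm_num))).div l0 (by simp [hy])).congr e1
      (by norm_num) (by field_simp; try ring)
  -- step 1
  have lt1 : Lead (HahnSeries.C (q * τ) - x1) (-1) (-(a * τ ^ 2 / (τ * y + 1))) :=
    (((Lead.C (q * τ)).weaken (-1) (by norm_num)).sub l1).congr rfl rfl (by ring)
  obtain ⟨P1, x2, lP1, e2, r2, s2⟩ := step_lead a (q * τ) x1 _ _ r1 (k' := 1)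
    (c' := q ^ 2 * (τ * y + 1) * y) l1 lt1 lP0
    (by simp [ha, hq, hτ, hy, h1, h2]) (by simp [ha, hq, hτ, hy, h1, h2]) (by simp [ha, hq, hτ, hy, h1, h2]) (by norm_num) (by field_simp)
  have l2 : Lead x2 1 (-((τ * y + 1) / (a * τ ^ 2))) :=
    (((lP1.weaken 0 (by norm_num)).sub Lead.one).div l1 (by simp [ha, hq, hτ, hy, h1, h2])).congr e2
      (by norm_num) (by field_simp; try ring)
  -- step 2
  have lt2 : Lead (HahnSeries.C (q ^ 2 * τ) - x2) 0 (q ^ 2 * τ) :=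
    ((Lead.C (q ^ 2 * τ)).sub (l2.weaken 0 (by norm_num))).congr rfl rfl (by ring)
  obtain ⟨P2, x3, lP2, e3, r3, s3⟩ := step_lead a (q ^ 2 * τ) x2 _ _ r2 (k' := 0)
    (c' := -(1 / (τ * y))) l2 lt2 lP1
    (by simp [ha, hq, hτ, hy, h1, h2]) (by simp [ha, hq, hτ, hy, h1, h2]) (by simp [ha, hq, hτ, hy, h1, h2]) (by norm_num) (by field_simp)
  have l3 : Lead x3 (-1) (a * τ / y) :=
    ((lP2.sub Lead.one).div l2 (by simp [ha, hq, hτ, hy, h1, h2])).congr e3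
      (by norm_num) (by field_simp; try ring)
  -- step 3
  have lt3 : Lead (HahnSeries.C (q ^ 3 * τ) - x3) (-1) (-(a * τ / y)) :=
    (((Lead.C (q ^ 3 * τ)).weaken (-1) (by norm_num)).sub l3).congr rfl rfl (by ring)
  obtain ⟨P3, x4, lP3, e4, r4, s4⟩ := step_lead a (q ^ 3 * τ) x3 _ _ r3 (k' := 0)
    (c' := a * q ^ 6 * τ ^ 3 * y) l3 lt3 lP2
    (by simp [ha, hq, hτ, hy, h1, h2]) (by simp [ha, hq, hτ, hy, h1, h2]) (by simp [ha, hq, hτ, hy, h1, h2]) (by norm_num) (by field_simp)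
  have l4 : Lead x4 1 ((a * q ^ 6 * τ ^ 3 * y - 1) * y / (a * τ)) :=
    ((lP3.sub Lead.one).div l3 (by simp [ha, hq, hτ, hy, h1, h2])).congr e4
      (by norm_num) (by field_simp; try ring)
  -- step 4
  have lt4 : Lead (HahnSeries.C (q ^ 4 * τ) - x4) 0 (q ^ 4 * τ) :=
    ((Lead.C (q ^ 4 * τ)).sub (l4.weaken 0 (by norm_num))).congr rfl rfl (by ring)
  obtain ⟨P4, x5, lP4, e5, r5, s5⟩ := step_lead a (q ^ 4 * τ) x4 _ _ r4 (k' := 1)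
    (c' := (a * q ^ 6 * τ ^ 3 * y - 1) / (a * q ^ 2 * τ ^ 3)) l4 lt4 lP3
    (by simp [ha, hq, hτ, hy, h1, h2]) (by simp [ha, hq, hτ, hy, h1, h2]) (by simp [ha, hq, hτ, hy, h1, h2]) (by norm_num) (by field_simp)
  have l5 : Lead x5 (-1) (-((a * τ) / ((a * q ^ 6 * τ ^ 3 * y - 1) * y))) :=
    (((lP4.weaken 0 (by norm_num)).sub Lead.one).div l4 (by simp [ha, hq, hτ, hy, h1, h2])).congr e5
      (by norm_num) (by field_simp; try ring)
  -- step 5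
  have lt5 : Lead (HahnSeries.C (q ^ 5 * τ) - x5) (-1)
      ((a * τ) / ((a * q ^ 6 * τ ^ 3 * y - 1) * y)) :=
    (((Lead.C (q ^ 5 * τ)).weaken (-1) (by norm_num)).sub l5).congr rfl rfl (by ring)
  obtain ⟨P5, x6, lP5, e6, r6, s6⟩ := step_lead a (q ^ 5 * τ) x5 _ _ r5 (k' := -1)
    (c' := -(a ^ 2 * q ^ 12 * τ ^ 5 / (a * q ^ 6 * τ ^ 3 * y - 1))) l5 lt5 lP4
    (by simp [ha, hq, hτ, hy, h1, h2]) (by simp [ha, hq, hτ, hy, h1, h2]) (by simp [ha, hq, hτ, hy, h1, h2]) (by norm_num) (by field_simp)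
  have l6 : Lead x6 0 (a * q ^ 12 * τ ^ 4 * y) :=
    ((lP5.sub (Lead.one.weaken (-1) (by norm_num))).div l5 (by simp [ha, hq, hτ, hy, h1, h2])).congr e6
      (by norm_num) (by field_simp; try ring)
  -- step 6
  have lt6 : Lead (HahnSeries.C (q ^ 6 * τ) - x6) 0
      (-(q ^ 6 * τ * (a * q ^ 6 * τ ^ 3 * y - 1))) :=
    ((Lead.C (q ^ 6 * τ)).sub l6).congr rfl rfl (by ring)
  obtain ⟨P6, x7, lP6, e7, r7, s7⟩ := step_lead a (q ^ 6 * τ) x6 _ _ r6 (k' := 1)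
    (c' := _) l6 lt6 lP5
    (by simp [ha, hq, hτ, hy, h1, h2]) (by simp [ha, hq, hτ, hy, h1, h2]) (by simp [ha, hq, hτ, hy, h1, h2]) (by norm_num) rfl
  have l7 : Lead x7 0 (-(1 / (a * q ^ 12 * τ ^ 4 * y))) :=
    (((lP6.weaken 0 (by norm_num)).sub Lead.one).div l6 (by simp [ha, hq, hτ, hy, h1, h2])).congr e7
      (by norm_num) (by ring)
  exact ⟨x6, x7, l6, l7, by rw [s1, s2, s3, s4, s5, s6, s7]⟩

end

lemma ratFunc_ne {F : Type*} [Field F] (c d : F) (hc : c ≠ 0) :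
    RatFunc.C c * RatFunc.X + RatFunc.C d ≠ (0 : RatFunc F) := by
  intro h
  have h' : algebraMap (Polynomial F) (RatFunc F)
      (Polynomial.C c * Polynomial.X + Polynomial.C d) = 0 := by
    rw [map_add, map_mul, RatFunc.algebraMap_C, RatFunc.algebraMap_X, RatFunc.algebraMap_C]
    exact h
  have h3 := (map_eq_zero_iff _ (RatFunc.algebraMap_injective F)).1 h'
  have := congrArg (fun p => Polynomial.coeff p 1) h3
  simp [Polynomial.coeff_C] at this
  exact hc this

/-- Singularity confinement for qP_II at xy + 1 = 0, confined after 7 steps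
(case (v) of the almost-good-reduction proof): work over the field of formal
Laurent series K((ε)), K = F(y), and start from x = −1/y + ε.  Then the 7-fold
iterate of the qP_II map (the parameter τ being multiplied by q at each step)
has both coordinates in K[[ε]] (no negative-order coefficients), and its
constant term at ε = 0 is (−1/(a q¹² τ⁴ y), a q¹² τ⁴ y). -/
theorem qp2_singularity_confinement (F : Type*) [Field F] [CharZero F]
    (a q τ : F) (ha : a ≠ 0) (hq : q ≠ 0) (hτ : τ ≠ 0) :
    ∀ aL qL τL yL ε x : LaurentSeries (RatFunc F),
      aL = HahnSeries.C (RatFunc.C a) → qL = HahnSeries.C (RatFunc.C q) →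
      τL = HahnSeries.C (RatFunc.C τ) → yL = HahnSeries.C (RatFunc.X : RatFunc F) →
      ε = HahnSeries.single 1 1 → x = -yL⁻¹ + ε →
    ∀ S : LaurentSeries (RatFunc F) × LaurentSeries (RatFunc F),
      S = qp2Step aL (qL ^ 6 * τL) (qp2Step aL (qL ^ 5 * τL)
            (qp2Step aL (qL ^ 4 * τL) (qp2Step aL (qL ^ 3 * τL)
              (qp2Step aL (qL ^ 2 * τL) (qp2Step aL (qL * τL)
                (qp2Step aL τL (x, yL))))))) →
      ((∀ i : ℤ, i < 0 → S.1.coeff i = 0) ∧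
       (∀ i : ℤ, i < 0 → S.2.coeff i = 0) ∧
       S.1.coeff 0 = -(1 / (RatFunc.C a * RatFunc.C q ^ 12 * RatFunc.C τ ^ 4 * RatFunc.X)) ∧
       S.2.coeff 0 = RatFunc.C a * RatFunc.C q ^ 12 * RatFunc.C τ ^ 4 * RatFunc.X) := by
  rintro aL qL τL yL ε x rfl rfl rfl rfl rfl rfl S rfl
  have ha' : (RatFunc.C a : RatFunc F) ≠ 0 := by simpa using ha
  have hq' : (RatFunc.C q : RatFunc F) ≠ 0 := by simpa using hq
  have hτ' : (RatFunc.C τ : RatFunc F) ≠ 0 := by simpa using hτ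
  obtain ⟨x6, x7, l6, l7, hs⟩ := confinement (RatFunc.C a) (RatFunc.C q) (RatFunc.C τ)
    (RatFunc.X : RatFunc F) ha' hq' hτ' RatFunc.X_ne_zero
    (by simpa using ratFunc_ne τ 1 hτ)
    (by
      have := ratFunc_ne (a * q ^ 6 * τ ^ 3) (-1) (by simp [ha, hq, hτ])
      simpa [sub_eq_add_neg] using this)
  simp only [map_mul, map_pow] at hs
  rw [hs]
  exact ⟨l7.coeff.1, l6.coeff.1, l7.coeff.2, l6.coeff.2⟩
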